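/- For all integers l ≥ 1 and s ≥ 2, every K_s-free graph G on n vertices, with n ≥ R(l,s) (the Ramsey number), contains at least C(n, R(l,s)) / C(n - l, R(l,s) - l) independent sets of size l. In particular, the number of independent l-sets in an n-vertex K_s-free graph is Θ(n^l). -/

import Mathlib

open SimpleGraph Finset

variable {V : Type*}

/-- The graph `G` with the edge `u v` added. -/
def addEdge (G : SimpleGraph V) (u v : V) : SimpleGraph V :=
  G ⊔ SimpleGraph.fromEdgeSet {s(u, v)}

/-- `G` is `K_s`-saturated: `G` is `K_s`-free and adding any missing edge creates a `K_s`. -/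
def KSat (s : ℕ) (G : SimpleGraph V) : Prop :=
  G.CliqueFree s ∧ ∀ u v : V, u ≠ v → ¬ G.Adj u v → ¬ (addEdge G u v).CliqueFree s

/-- The number of copies of `K_r` in `G`: the number of `r`-sets of vertices inducing
a complete graph. -/
noncomputable def cliqueCount (G : SimpleGraph V) (r : ℕ) : ℕ :=
  {t : Finset V | G.IsNClique r t}.ncard

/-- `sat(n, K_r, K_s)`: minimum number of copies of `K_r` in an `n`-vertex
`K_s`-saturated graph. -/
noncomputable def satCliques (n r s : ℕ) : ℕ :=
  sInf {m | ∃ G : SimpleGraph (Fin n), KSat s G ∧ cliqueCount G r = m}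

/-- The join `K_{s-2} ∗ ∅_{n-s+2}` on `Fin n`. -/
def joinGraph (n s : ℕ) : SimpleGraph (Fin n) :=
  SimpleGraph.fromRel (fun i _ => (i : ℕ) < s - 2)

/-- The number of copies of `C_r` in `G` : the number of subgraphs of `G`
isomorphic to the cycle on `r` vertices. -/
noncomputable def cycleCount (G : SimpleGraph V) (r : ℕ) : ℕ :=
  {H : G.Subgraph | Nonempty (H.coe ≃g cycleGraph r)}.ncard

/-- `sat(n, C_r, K_s)`. -/
noncomputable def satCyclesCliqueSat (n r s : ℕ) : ℕ :=
  sInf {m | ∃ G : SimpleGraph (Fin n), KSat s G ∧ cycleCount G r = m}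

/-- `G` contains a copy of `F`, i.e. a subgraph isomorphic to `F`. -/
def ContainsCopy {α β : Type*} (F : SimpleGraph α) (G : SimpleGraph β) : Prop :=
  ∃ f : α → β, Function.Injective f ∧ ∀ a b : α, F.Adj a b → G.Adj (f a) (f b)

/-- strongly K_s-saturated -/
def StronglyKSat (s : ℕ) (G : SimpleGraph V) : Prop :=
  ∀ u v : V, u ≠ v → ¬ G.Adj u v →
    ∃ t : Finset V, (addEdge G u v).IsNClique s t ∧ u ∈ t ∧ v ∈ t

/-- dumbbell -/
def dumbbell (m : ℕ) : SimpleGraph (Fin (2 * m)) :=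
  SimpleGraph.fromRel (fun i j =>
    ((i : ℕ) < m ∧ (j : ℕ) < m) ∨ (m ≤ (i : ℕ) ∧ m ≤ (j : ℕ)) ∨ ((i : ℕ) = 0 ∧ (j : ℕ) = m))

def Vgraph (m : ℕ) : SimpleGraph (Fin (m + 2)) :=
  SimpleGraph.fromRel (fun i j =>
    ((i : ℕ) < m ∧ (j : ℕ) < m) ∨ ((i : ℕ) = 0 ∧ m ≤ (j : ℕ)))

def lambdaGraph (m : ℕ) : SimpleGraph (Fin (m + 1)) :=
  SimpleGraph.fromRel (fun i j =>
    ((i : ℕ) < m ∧ (j : ℕ) < m) ∨ ((i : ℕ) = m ∧ (j : ℕ) < 2))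

def VgraphGen (m r : ℕ) : SimpleGraph (Fin (m + (m - r))) :=
  SimpleGraph.fromRel (fun i j =>
    ((i : ℕ) < m ∧ (j : ℕ) < m) ∨
      (((i : ℕ) = 0 ∨ m ≤ (i : ℕ)) ∧ ((j : ℕ) = 0 ∨ m ≤ (j : ℕ))))

def lambdaGraphGen (m r : ℕ) : SimpleGraph (Fin (m + 1)) :=
  SimpleGraph.fromRel (fun i j =>
    ((i : ℕ) < m ∧ (j : ℕ) < m) ∨ ((i : ℕ) = m ∧ (j : ℕ) < r))

/-- `G` is saturated with respect to the family `{F₁, F₂, F₃}`. -/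
def FamSat3 {α₁ α₂ α₃ : Type*} (F₁ : SimpleGraph α₁) (F₂ : SimpleGraph α₂)
    (F₃ : SimpleGraph α₃) (G : SimpleGraph V) : Prop :=
  ¬ ContainsCopy F₁ G ∧ ¬ ContainsCopy F₂ G ∧ ¬ ContainsCopy F₃ G ∧
    ∀ u v : V, u ≠ v → ¬ G.Adj u v →
      ContainsCopy F₁ (addEdge G u v) ∨ ContainsCopy F₂ (addEdge G u v) ∨
        ContainsCopy F₃ (addEdge G u v)

noncomputable def satFam3 {α₁ α₂ α₃ : Type*} (n : ℕ) (F₁ : SimpleGraph α₁)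
    (F₂ : SimpleGraph α₂) (F₃ : SimpleGraph α₃) : ℕ :=
  sInf {m | ∃ G : SimpleGraph (Fin n), FamSat3 F₁ F₂ F₃ G ∧ G.edgeSet.ncard = m}

noncomputable def satCliquesFam3 {α₁ α₂ α₃ : Type*} (n r : ℕ) (F₁ : SimpleGraph α₁)
    (F₂ : SimpleGraph α₂) (F₃ : SimpleGraph α₃) : ℕ :=
  sInf {m | ∃ G : SimpleGraph (Fin n), FamSat3 F₁ F₂ F₃ G ∧ cliqueCount G r = m}

/-- saturation w.r.t. a single graph, with copies as subgraphs. -/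
def SatGraph {α : Type*} (F : SimpleGraph α) (G : SimpleGraph V) : Prop :=
  ¬ ContainsCopy F G ∧ ∀ u v : V, u ≠ v → ¬ G.Adj u v → ContainsCopy F (addEdge G u v)

noncomputable def satCyclesGraphSat {α : Type*} (n r : ℕ) (F : SimpleGraph α) : ℕ :=
  sInf {m | ∃ G : SimpleGraph (Fin n), SatGraph F G ∧ cycleCount G r = m}

/-- number of independent sets of size l -/
noncomputable def indepCount (G : SimpleGraph V) (l : ℕ) : ℕ :=
  {t : Finset V | t.card = l ∧ ∀ a ∈ t, ∀ b ∈ t, ¬ G.Adj a b}.ncard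

/-- Ramsey number -/
noncomputable def ramsey (l s : ℕ) : ℕ :=
  sInf {N | ∀ G : SimpleGraph (Fin N),
    (∃ t : Finset (Fin N), t.card = l ∧ ∀ a ∈ t, ∀ b ∈ t, ¬ G.Adj a b) ∨
      ∃ t : Finset (Fin N), G.IsNClique s t}

/-- Finite Ramsey theorem for graphs, relative to a finite vertex set `A`. -/
theorem exists_card_forces_indep_or_clique (V : Type*) (l s : ℕ) :
    ∃ N : ℕ, ∀ (G : SimpleGraph V) (A : Finset V), N ≤ A.card →
      (∃ t ⊆ A, t.card = l ∧ ∀ a ∈ t, ∀ b ∈ t, ¬ G.Adj a b) ∨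
        ∃ t ⊆ A, G.IsNClique s t := by
  classical
  induction l generalizing s with
  | zero => exact ⟨0, fun G A _ => Or.inl ⟨∅, by simp⟩⟩
  | succ l ihl =>
    induction s with
    | zero => exact ⟨0, fun G A _ => Or.inr ⟨∅, by simp⟩⟩
    | succ s ihs =>
      obtain ⟨N₁, h₁⟩ := ihl (s + 1)
      obtain ⟨N₂, h₂⟩ := ihs
      refine ⟨N₁ + N₂ + 1, fun G A hA => ?_⟩
      obtain ⟨v, hv⟩ : A.Nonempty := card_pos.mp (by omega)
      have hsplit := card_filter_add_card_filter_not (s := A.erase v) (fun w => G.Adj v w)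
      rw [card_erase_of_mem hv] at hsplit
      by_cases hN : N₁ ≤ ((A.erase v).filter (fun w => ¬ G.Adj v w)).card
      · rcases h₁ G _ hN with ⟨t, htA, htc, hti⟩ | ⟨t, htA, ht⟩
        · have hmem : ∀ w ∈ t, w ≠ v ∧ w ∈ A ∧ ¬ G.Adj v w := fun w hw => by
            simpa [and_assoc] using htA hw
          refine Or.inl ⟨insert v t, ?_, ?_, ?_⟩
          · exact insert_subset hv fun w hw => (hmem w hw).2.1
          · rw [card_insert_of_notMem (fun h => (hmem v h).1 rfl), htc]
          · simp only [mem_insert, forall_eq_or_imp, SimpleGraph.irrefl, not_false_eq_true,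
              true_and]
            exact ⟨fun w hw => (hmem w hw).2.2,
              fun w hw => ⟨fun h => (hmem w hw).2.2 h.symm, hti w hw⟩⟩
        · exact Or.inr ⟨t, htA.trans ((filter_subset _ _).trans (erase_subset _ _)), ht⟩
      · have hN' : N₂ ≤ ((A.erase v).filter (fun w => G.Adj v w)).card := by omega
        rcases h₂ G _ hN' with ⟨t, htA, ht⟩ | ⟨t, htA, ht⟩
        · exact Or.inl ⟨t, htA.trans ((filter_subset _ _).trans (erase_subset _ _)), ht⟩
        · have hmem : ∀ w ∈ t, w ≠ v ∧ w ∈ A ∧ G.Adj v w := fun w hw => by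
            simpa [and_assoc] using htA hw
          exact Or.inr ⟨insert v t, insert_subset hv fun w hw => (hmem w hw).2.1,
            ht.insert fun w hw => (hmem w hw).2.2⟩

theorem ramsey_spec (l s : ℕ) (G : SimpleGraph (Fin (ramsey l s))) :
    (∃ t : Finset (Fin (ramsey l s)), t.card = l ∧ ∀ a ∈ t, ∀ b ∈ t, ¬ G.Adj a b) ∨
      ∃ t : Finset (Fin (ramsey l s)), G.IsNClique s t := by
  refine Nat.sInf_mem (s := {N | ∀ G : SimpleGraph (Fin N),
    (∃ t : Finset (Fin N), t.card = l ∧ ∀ a ∈ t, ∀ b ∈ t, ¬ G.Adj a b) ∨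
      ∃ t : Finset (Fin N), G.IsNClique s t}) ?_ G
  obtain ⟨N, hN⟩ := exists_card_forces_indep_or_clique ℕ l s
  refine ⟨N, fun G => ?_⟩
  have hpre : ∀ t : Finset ℕ, t ⊆ range N →
      ∃ t' : Finset (Fin N), t'.map Fin.valEmbedding = t := fun t ht =>
    ⟨t.attachFin fun m hm => mem_range.mp (ht hm), map_valEmbedding_attachFin _⟩
  rcases hN (G.map Fin.valEmbedding) (range N) (card_range N).ge with
    ⟨t, htA, htc, hti⟩ | ⟨t, htA, ht⟩
  · obtain ⟨t, rfl⟩ := hpre t htA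
    refine Or.inl ⟨t, by simpa using htc, fun a ha b hb hab => ?_⟩
    exact hti _ (mem_map_of_mem _ ha) _ (mem_map_of_mem _ hb)
      ((SimpleGraph.map_adj_apply ..).mpr hab)
  · obtain ⟨t, rfl⟩ := hpre t htA
    refine Or.inr ⟨t, ?_, by simpa using ht.card_eq⟩
    intro a ha b hb hab
    exact (SimpleGraph.map_adj_apply ..).mp <| ht.isClique
      (mem_coe.mpr (mem_map_of_mem Fin.valEmbedding ha))
      (mem_coe.mpr (mem_map_of_mem Fin.valEmbedding hb)) (Fin.valEmbedding.injective.ne hab)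

theorem exists_indep_subset_of_card_eq_ramsey {n l s : ℕ} {G : SimpleGraph (Fin n)}
    (hG : G.CliqueFree s) {S : Finset (Fin n)} (hS : S.card = ramsey l s) :
    ∃ t ⊆ S, t.card = l ∧ ∀ a ∈ t, ∀ b ∈ t, ¬ G.Adj a b := by
  let f := (S.orderEmbOfFin hS).toEmbedding
  rcases ramsey_spec l s (G.comap f) with ⟨t, htc, hti⟩ | ⟨t, ht⟩
  · refine ⟨t.map f, fun x hx => ?_, by simpa using htc, ?_⟩
    · obtain ⟨y, -, rfl⟩ := mem_map.mp hx
      exact orderEmbOfFin_mem S hS y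
    · simpa using hti
  · exact (hG.comap ⟨(Embedding.comap f G).toCopy⟩ t ht).elim

theorem card_filter_superset_powersetCard_le {α : Type*} [Fintype α] [DecidableEq α]
    (t : Finset α) (k : ℕ) :
    (((univ : Finset α).powersetCard k).filter (t ⊆ ·)).card
      ≤ (Fintype.card α - t.card).choose (k - t.card) := by
  rw [← card_compl, ← card_powersetCard]
  refine card_le_card_of_injOn (· \ t) (fun S hS => ?_) fun S hS T hT hST => ?_
  · simp only [coe_filter, mem_powersetCard, Set.mem_ofPred_eq] at hS
    rw [mem_coe, mem_powersetCard]
    refine ⟨fun x hx => mem_compl.mpr (mem_sdiff.mp hx).2, ?_⟩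
    rw [card_sdiff_of_subset hS.2, hS.1.2]
  · simp only [coe_filter, Set.mem_ofPred_eq] at hS hT
    rw [← sdiff_union_of_subset hS.2, ← sdiff_union_of_subset hT.2]
    exact congrArg (· ∪ t) hST

/-- For `l ≥ 1`, `s ≥ 2`, every `K_s`-free graph on `n ≥ R(l,s)` vertices has
at least `C(n, R(l,s)) / C(n-l, R(l,s)-l)` independent sets of size `l`. -/
theorem ramsey_indep_count (l s : ℕ) (hl : 1 ≤ l) (hs : 2 ≤ s) (n : ℕ)
    (hn : ramsey l s ≤ n) (G : SimpleGraph (Fin n)) (hG : G.CliqueFree s) :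
    (n.choose (ramsey l s) : ℝ) / ((n - l).choose (ramsey l s - l) : ℝ)
      ≤ (indepCount G l : ℝ) := by
  classical
  refine div_le_of_le_mul₀ (Nat.cast_nonneg _) (Nat.cast_nonneg _) ?_
  let I : Finset (Finset (Fin n)) :=
    univ.filter fun t => t.card = l ∧ ∀ a ∈ t, ∀ b ∈ t, ¬ G.Adj a b
  have hI : indepCount G l = I.card := by
    rw [indepCount, ← Set.ncard_coe_finset]
    simp [I]
  rw [hI]
  have key := card_mul_le_card_mul (s := (univ : Finset (Fin n)).powersetCard (ramsey l s))
    (t := I) (fun S t => t ⊆ S) (m := 1) (n := (n - l).choose (ramsey l s - l))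
    (fun S hS => by
      obtain ⟨t, htS, ht⟩ :=
        exists_indep_subset_of_card_eq_ramsey hG (mem_powersetCard.mp hS).2
      exact card_pos.mpr ⟨t, by simpa [bipartiteAbove, I, htS] using ht⟩)
    (fun t ht => by
      have htc : t.card = l := (mem_filter.mp ht).2.1
      simpa [bipartiteBelow, htc] using card_filter_superset_powersetCard_le t (ramsey l s))
  rw [card_powersetCard, card_univ, Fintype.card_fin, mul_one] at key
  exact_mod_cast key
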